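/- Let p be a positive integer and let θ, α ∈ ℝ. Then for every θ₀ ∈ Θ_α and every θ* ∈ Θ* one has the upper bound |Λ(θ,α)| ≤ p²·|θ − θ₀|·((1/2)|θ − θ₀| + |θ₀ − θ*|). -/

import Mathlib

/-- `Λ(θ,α) = cos(pθ) − (−1)^p cos(pα)`. -/
noncomputable def Lam (p : ℕ) (θ α : ℝ) : ℝ :=
  Real.cos (p * θ) - (-1 : ℝ) ^ p * Real.cos (p * α)

/-- `Θ_α = {θ ∈ ℝ : Λ(θ,α) = 0}`. -/
def ThetaAlpha (p : ℕ) (α : ℝ) : Set ℝ := {θ : ℝ | Lam p θ α = 0}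

/-- `Θ* = {nπ/p : n ∈ ℤ}`. -/
def ThetaStar (p : ℕ) : Set ℝ := {τ : ℝ | ∃ n : ℤ, τ = n * Real.pi / p}

/-- `|cos x - cos y|` is controlled by `|x - y|` and the distance of `y` to a zero of `sin`. -/
theorem abs_cos_sub_cos_le (x y : ℝ) (n : ℤ) :
    |Real.cos x - Real.cos y| ≤ |x - y| * (|x - y| / 2 + |y - n * Real.pi|) := by
  have half_diff : |Real.sin ((x - y) / 2)| ≤ |x - y| / 2 := by
    simpa [abs_div] using Real.abs_sin_le_abs (x := (x - y) / 2)
  have half_sum : |Real.sin ((x + y) / 2)| ≤ |x - y| / 2 + |y - n * Real.pi| := by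
    calc |Real.sin ((x + y) / 2)| = |Real.sin ((x + y) / 2 - n * Real.pi)| := by
          rw [Real.sin_sub_int_mul_pi, abs_mul, abs_zpow, abs_neg, abs_one, one_zpow, one_mul]
      _ ≤ |(x + y) / 2 - n * Real.pi| := Real.abs_sin_le_abs
      _ = |(x - y) / 2 + (y - n * Real.pi)| := by ring_nf
      _ ≤ |(x - y) / 2| + |y - n * Real.pi| := abs_add_le _ _
      _ = |x - y| / 2 + |y - n * Real.pi| := by simp [abs_div]
  calc |Real.cos x - Real.cos y|
      = 2 * (|Real.sin ((x - y) / 2)| * |Real.sin ((x + y) / 2)|) := by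
        rw [Real.cos_sub_cos, abs_mul, abs_mul, abs_neg, abs_two]
        ring
    _ ≤ 2 * (|x - y| / 2 * (|x - y| / 2 + |y - n * Real.pi|)) := by gcongr
    _ = |x - y| * (|x - y| / 2 + |y - n * Real.pi|) := by ring

/-- Upper bound of Lemma 1, valid for every `θ₀ ∈ Θ_α` and every `θ* ∈ Θ*`. -/
theorem upper_bound (p : ℕ) (hp : 0 < p) (θ α : ℝ) :
    ∀ θ₀ ∈ ThetaAlpha p α, ∀ θstar ∈ ThetaStar p,
      |Lam p θ α| ≤ (p : ℝ) ^ 2 * |θ - θ₀| * (|θ - θ₀| / 2 + |θ₀ - θstar|) := by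
  rintro θ₀ hθ₀ _ ⟨n, rfl⟩
  have hp' : (p : ℝ) ≠ 0 := by positivity
  have hLam : Lam p θ α = Real.cos (p * θ) - Real.cos (p * θ₀) := by
    have hzero : Real.cos (p * θ₀) - (-1 : ℝ) ^ p * Real.cos (p * α) = 0 := hθ₀
    unfold Lam
    linarith
  have hdiff : |p * θ - p * θ₀| = p * |θ - θ₀| := by
    rw [← mul_sub, abs_mul, Nat.abs_cast]
  have hstar : |p * θ₀ - n * Real.pi| = p * |θ₀ - n * Real.pi / p| := by
    rw [← Nat.abs_cast (R := ℝ) p, ← abs_mul, Nat.abs_cast, mul_sub, mul_div_cancel₀ _ hp']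
  calc |Lam p θ α|
      ≤ |p * θ - p * θ₀| * (|p * θ - p * θ₀| / 2 + |p * θ₀ - n * Real.pi|) :=
        hLam ▸ abs_cos_sub_cos_le _ _ n
    _ = (p : ℝ) ^ 2 * |θ - θ₀| * (|θ - θ₀| / 2 + |θ₀ - n * Real.pi / p|) := by
        rw [hdiff, hstar]
        ring
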